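/- If {W_i}_{i=1}^n ⊂ Gr(F,k,m) is equiisoclinic with common constant α > 0 (i.e., L_i* L_j L_j* L_i = α·I_m for all i ≠ j) and the subspaces are not all equal, and if {W_i^⊥}_{i=1}^n is also equiisoclinic, then k = 2m. -/

import Mathlib

open Matrix

/-- A matrix with scalar nonzero Gram matrix has at least as many rows as columns. -/
theorem card_cols_le_of_conjTranspose_mul_self_eq_smul_one {F : Type*} [RCLike F] {m m' : ℕ}
    (A : Matrix (Fin m') (Fin m) F) {c : F} (hc : c ≠ 0) (hA : Aᴴ * A = c • 1) : m ≤ m' := by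
  have h1 : (c⁻¹ • Aᴴ) * A = 1 := by
    rw [Matrix.smul_mul, hA, smul_smul, inv_mul_cancel₀ hc, one_smul]
  have h2 := Matrix.rank_mul_le_right (c⁻¹ • Aᴴ) A
  rw [h1, Matrix.rank_one, Fintype.card_fin] at h2
  exact h2.trans (by simpa using A.rank_le_card_height)

/-- The Gram matrix between a subspace and the complement of another one. -/
theorem conjTranspose_mul_self_of_complement {F : Type*} [RCLike F] {k m m' : ℕ}
    {L₁ L₂ : Matrix (Fin k) (Fin m) F} {M₂ : Matrix (Fin k) (Fin m') F} {a : F}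
    (hL₁ : L₁ᴴ * L₁ = 1) (h₂ : L₂ * L₂ᴴ + M₂ * M₂ᴴ = 1)
    (hiso : L₁ᴴ * L₂ * L₂ᴴ * L₁ = a • 1) :
    (M₂ᴴ * L₁)ᴴ * (M₂ᴴ * L₁) = (1 - a) • 1 := by
  calc (M₂ᴴ * L₁)ᴴ * (M₂ᴴ * L₁) = L₁ᴴ * (M₂ * M₂ᴴ) * L₁ := by
        simp only [conjTranspose_mul, conjTranspose_conjTranspose, Matrix.mul_assoc]
    _ = L₁ᴴ * L₁ - L₁ᴴ * L₂ * L₂ᴴ * L₁ := by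
        rw [eq_sub_of_add_eq' h₂]
        simp only [Matrix.mul_sub, Matrix.sub_mul, Matrix.mul_one, Matrix.mul_assoc]
    _ = (1 - a) • 1 := by rw [hL₁, hiso, sub_smul, one_smul]

/-- If the cross-Gram product is the identity, the first subspace lies in the second. -/
theorem projection_mul_eq_of_isoclinic_one {F : Type*} [RCLike F] {k m m' : ℕ}
    {L₁ L₂ : Matrix (Fin k) (Fin m) F} {M₂ : Matrix (Fin k) (Fin m') F}
    (hL₁ : L₁ᴴ * L₁ = 1) (h₂ : L₂ * L₂ᴴ + M₂ * M₂ᴴ = 1)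
    (hiso : L₁ᴴ * L₂ * L₂ᴴ * L₁ = (1 : F) • 1) :
    (L₂ * L₂ᴴ) * (L₁ * L₁ᴴ) = L₁ * L₁ᴴ := by
  have hz : M₂ᴴ * L₁ = 0 := by
    open scoped ComplexOrder in
    rw [← conjTranspose_mul_self_eq_zero, conjTranspose_mul_self_of_complement hL₁ h₂ hiso,
      sub_self, zero_smul]
  have hz' : M₂ * M₂ᴴ * (L₁ * L₁ᴴ) = 0 := by
    rw [Matrix.mul_assoc, ← Matrix.mul_assoc M₂ᴴ, hz, Matrix.zero_mul, Matrix.mul_zero]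
  rw [eq_sub_of_add_eq h₂, Matrix.sub_mul, hz', Matrix.one_mul, sub_zero]

/-- Two distinct mutually isoclinic subspaces have dimension at most that of the complement. -/
theorem dim_le_of_isoclinic_of_ne {F : Type*} [RCLike F] {k m m' : ℕ}
    {L₁ L₂ : Matrix (Fin k) (Fin m) F} {M₁ M₂ : Matrix (Fin k) (Fin m') F} {a : F}
    (hL₁ : L₁ᴴ * L₁ = 1) (hL₂ : L₂ᴴ * L₂ = 1)
    (h₁ : L₁ * L₁ᴴ + M₁ * M₁ᴴ = 1) (h₂ : L₂ * L₂ᴴ + M₂ * M₂ᴴ = 1)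
    (hiso : L₁ᴴ * L₂ * L₂ᴴ * L₁ = a • 1) (hiso' : L₂ᴴ * L₁ * L₁ᴴ * L₂ = a • 1)
    (hne : L₁ * L₁ᴴ ≠ L₂ * L₂ᴴ) : m ≤ m' := by
  refine card_cols_le_of_conjTranspose_mul_self_eq_smul_one _ (fun ha => hne ?_)
    (conjTranspose_mul_self_of_complement hL₁ h₂ hiso)
  obtain rfl : 1 = a := sub_eq_zero.mp ha
  have e₁ := projection_mul_eq_of_isoclinic_one hL₁ h₂ hiso
  have e₂ := projection_mul_eq_of_isoclinic_one hL₂ h₁ hiso'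
  have e₃ := congrArg conjTranspose e₂
  simp only [conjTranspose_mul, conjTranspose_conjTranspose] at e₃
  exact e₁.symm.trans e₃

theorem complement_equiisoclinic_implies_half_dim {F : Type*} [RCLike F] {k m m' n : ℕ}
    (L : Fin n → Matrix (Fin k) (Fin m) F)
    (M : Fin n → Matrix (Fin k) (Fin m') F)
    (hL : ∀ i, (L i)ᴴ * L i = 1)
    (hM : ∀ i, (M i)ᴴ * M i = 1)
    (hcomp : ∀ i, L i * (L i)ᴴ + M i * (M i)ᴴ = 1)
    (hiso : ∃ α : ℝ, 0 < α ∧ ∀ i j, i ≠ j →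
        (L i)ᴴ * L j * (L j)ᴴ * L i = (α : F) • 1)
    (hnotall : ∃ i j, L i * (L i)ᴴ ≠ L j * (L j)ᴴ)
    (hisoperp : ∃ β : ℝ, 0 < β ∧ ∀ i j, i ≠ j →
        (M i)ᴴ * M j * (M j)ᴴ * M i = (β : F) • 1) :
    k = 2 * m := by
  obtain ⟨α, -, hα⟩ := hiso
  obtain ⟨β, -, hβ⟩ := hisoperp
  obtain ⟨i, j, hne⟩ := hnotall
  have hij : i ≠ j := by rintro rfl; exact hne rfl
  have hcomp' : ∀ i, M i * (M i)ᴴ + L i * (L i)ᴴ = 1 := fun i => by rw [add_comm, hcomp]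
  have hne' : M i * (M i)ᴴ ≠ M j * (M j)ᴴ := fun h => hne <| by
    rw [eq_sub_of_add_eq (hcomp i), eq_sub_of_add_eq (hcomp j), h]
  have hle : m ≤ m' := dim_le_of_isoclinic_of_ne (hL i) (hL j) (hcomp i) (hcomp j)
    (hα i j hij) (hα j i hij.symm) hne
  have hge : m' ≤ m := dim_le_of_isoclinic_of_ne (hM i) (hM j) (hcomp' i) (hcomp' j)
    (hβ i j hij) (hβ j i hij.symm) hne'
  have htr : (m : F) + m' = k := by
    have h := congrArg trace (hcomp i)
    rw [trace_add, trace_mul_comm, hL, trace_mul_comm, hM] at h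
    simpa using h
  have hk : m + m' = k := by exact_mod_cast htr
  omega
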